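/- Let q ≥ 1 be an integer and let γ ∈ (0,1). Define Step_{q,γ}(x) = T_q(2(1−x)/(1−γ) − 1) / T_q(2/(1−γ) − 1), where T_q denotes the degree-q Chebyshev polynomial of the first kind. Then for every real x with γ ≤ x ≤ 1, one has |Step_{q,γ}(x)| ≤ 2·exp(−2·q·√γ). -/

import Mathlib

open Polynomial

/-- `artanh s ≥ s` on `[0, 1)`, in logarithmic form. -/
lemma two_mul_le_log_one_add_div_one_sub {s : ℝ} (h0 : 0 ≤ s) (h1 : s < 1) :
    2 * s ≤ Real.log ((1 + s) / (1 - s)) := by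
  have h := Real.sum_range_le_log_div h0 h1 1
  norm_num at h
  linarith

lemma cosh_log_one_add_div_one_sub {s : ℝ} (h0 : 0 ≤ s) (h1 : s < 1) :
    Real.cosh (Real.log ((1 + s) / (1 - s))) = 2 / (1 - s ^ 2) - 1 := by
  have h2 : 0 < 1 - s := by linarith
  have h3 : 0 < 1 + s := by linarith
  have h4 : 1 - s ^ 2 ≠ 0 := by nlinarith
  rw [Real.cosh_log (by positivity)]
  field_simp
  ring

/-- Exponential growth of the Chebyshev polynomial `T_n` to the right of `1`. -/
lemma exp_div_two_le_eval_chebyshev_T (n : ℕ) {γ : ℝ} (h0 : 0 ≤ γ) (h1 : γ < 1) :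
    Real.exp (2 * n * √γ) / 2 ≤ (Polynomial.Chebyshev.T ℝ n).eval (2 / (1 - γ) - 1) := by
  have hs1 : √γ < 1 := by rwa [Real.sqrt_lt' one_pos, one_pow]
  have hcosh := cosh_log_one_add_div_one_sub (Real.sqrt_nonneg γ) hs1
  rw [Real.sq_sqrt h0] at hcosh
  rw [← hcosh, Polynomial.Chebyshev.T_real_cosh, Int.cast_natCast, Real.cosh_eq]
  have hθ : 2 * n * √γ ≤ n * Real.log ((1 + √γ) / (1 - √γ)) := by
    have := mul_le_mul_of_nonneg_left
      (two_mul_le_log_one_add_div_one_sub (Real.sqrt_nonneg γ) hs1) n.cast_nonneg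
    linarith
  linarith [Real.exp_le_exp.mpr hθ, Real.exp_pos (-(n * Real.log ((1 + √γ) / (1 - √γ))))]

/-- **Lemma 3.5 (Chebyshev step polynomial bound).**
For every integer `q ≥ 1` and `γ ∈ (0,1)`, the function
`Step_{q,γ}(x) = T_q(2(1-x)/(1-γ) - 1) / T_q(2/(1-γ) - 1)`, built from the
degree-`q` Chebyshev polynomial of the first kind `T_q`, satisfies
`|Step_{q,γ}(x)| ≤ 2 exp(-2 q √γ)` for all `γ ≤ x ≤ 1`. -/
theorem chebyshev_step_bound (q : ℕ) (hq : 1 ≤ q) (γ : ℝ) (hγ0 : 0 < γ) (hγ1 : γ < 1)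
    (x : ℝ) (hx1 : γ ≤ x) (hx2 : x ≤ 1) :
    |(Polynomial.Chebyshev.T ℝ q).eval (2 * (1 - x) / (1 - γ) - 1) /
        (Polynomial.Chebyshev.T ℝ q).eval (2 / (1 - γ) - 1)| ≤
      2 * Real.exp (-2 * q * Real.sqrt γ) := by
  have hden := exp_div_two_le_eval_chebyshev_T q hγ0.le hγ1
  have hγ : 0 < 1 - γ := by linarith
  have harg : |2 * (1 - x) / (1 - γ) - 1| ≤ 1 := by
    have hnonneg : 0 ≤ 2 * (1 - x) / (1 - γ) := div_nonneg (by linarith) hγ.le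
    have hle : 2 * (1 - x) / (1 - γ) ≤ 2 := by rw [div_le_iff₀ hγ]; linarith
    rw [abs_le]
    constructor <;> linarith
  have hexp : 0 < Real.exp (2 * q * √γ) / 2 := by positivity
  rw [abs_div, abs_of_pos (hexp.trans_le hden)]
  calc _ ≤ 1 / (Real.exp (2 * q * √γ) / 2) :=
        div_le_div₀ zero_le_one (Polynomial.Chebyshev.abs_eval_T_real_le_one q harg) hexp hden
    _ = 2 * Real.exp (-2 * q * √γ) := by
        rw [one_div_div, div_eq_mul_inv, ← Real.exp_neg]
        ring_nf
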